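/- arXiv:2502.17010 — 5 statements merged into one kernel-verified Lean document; each statement's English description precedes it below -/
import Mathlib

section
/- Let p be a prime with p ≡ 3 (mod 4). Then the quaternion algebra (−1, −p / ℚ) is ramified exactly at p and at ∞; concretely: the base change of (−1, −p / ℚ) to ℝ is a division ring, the base change of (−1, −p / ℚ) to the p-adic field ℚ_p is a division ring, and for every prime ℓ ≠ p the base change of (−1, −p / ℚ) to ℚ_ℓ is isomorphic as a ℚ_ℓ-algebra to the ring of 2×2 matrices over ℚ_ℓ. -/
open Quaternion

lemma aux_unit {K : Type*} [Field K] (c : K)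
    (h : ∀ a b d e : K, a ^ 2 + b ^ 2 + c * (d ^ 2 + e ^ 2) = 0 → a = 0 ∧ b = 0 ∧ d = 0 ∧ e = 0)
    (x : ℍ[K, -1, -c]) (hx : x ≠ 0) : IsUnit x := by
  obtain ⟨a, b, d, e⟩ := x
  set n := a ^ 2 + b ^ 2 + c * (d ^ 2 + e ^ 2) with hn
  have hn0 : n ≠ 0 := by
    intro h0
    obtain ⟨rfl, rfl, rfl, rfl⟩ := h a b d e h0
    exact hx rfl
  refine ⟨⟨⟨a, b, d, e⟩, ⟨a / n, -b / n, -d / n, -e / n⟩, ?_, ?_⟩, rfl⟩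
  all_goals
    ext <;> simp <;> field_simp <;> rw [hn] <;> ring

lemma aux_sqrt {ℓ : ℕ} [Fact ℓ.Prime] (u a : ℤ_[ℓ]) (h : ‖a ^ 2 - u‖ < ‖2 * a‖ ^ 2) :
    ∃ z : ℤ_[ℓ], z ^ 2 = u := by
  have := hensels_lemma (p := ℓ) (F := (Polynomial.X ^ 2 - Polynomial.C u : Polynomial ℤ_[ℓ]))
    (a := a) (by simpa [Polynomial.derivative_X_pow, one_add_one_eq_two] using h)
  obtain ⟨z, hz, -⟩ := this
  exact ⟨z, by simpa [sub_eq_zero] using hz⟩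

lemma aux_toZMod {ℓ : ℕ} [Fact ℓ.Prime] (a : ℤ_[ℓ]) : ‖a‖ < 1 ↔ PadicInt.toZMod a = 0 := by
  rw [← RingHom.mem_ker, PadicInt.ker_toZMod, IsLocalRing.mem_maximalIdeal,
    PadicInt.mem_nonunits]

lemma aux_norm_one {ℓ : ℕ} [Fact ℓ.Prime] (a : ℤ_[ℓ]) (h : PadicInt.toZMod a ≠ 0) : ‖a‖ = 1 := by
  by_contra h1
  exact h ((aux_toZMod a).1 (lt_of_le_of_ne a.norm_le_one h1))

lemma aux_odd {ℓ : ℕ} [Fact ℓ.Prime] (h2 : ℓ ≠ 2) (u a b : ℤ_[ℓ])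
    (h : PadicInt.toZMod (a ^ 2 + b ^ 2) = PadicInt.toZMod u) (ha : PadicInt.toZMod a ≠ 0) :
    ∃ x y : ℤ_[ℓ], x ^ 2 + y ^ 2 = u := by
  obtain ⟨z, hz⟩ := aux_sqrt (u - b ^ 2) a (by
    have e : ‖2 * a‖ = 1 := by
      apply aux_norm_one
      rw [map_mul]
      refine mul_ne_zero ?_ ha
      rw [map_ofNat]
      exact Ring.two_ne_zero (by rwa [ZMod.ringChar_zmod_n])
    rw [e, one_pow, aux_toZMod]
    simp only [map_add, map_sub, map_pow] at h ⊢
    linear_combination h)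
  exact ⟨z, b, by rw [hz]; ring⟩

lemma aux_exists (p : ℕ) [hp : Fact p.Prime] (hp4 : p % 4 = 3) (ℓ : ℕ) [hl : Fact ℓ.Prime]
    (hne : ℓ ≠ p) : ∃ x y : ℤ_[ℓ], x ^ 2 + y ^ 2 = -(p : ℤ_[ℓ]) := by
  by_cases h2 : ℓ = 2
  · subst h2
    have key : ∀ m : ℤ, (8 : ℤ) ∣ 1 - m → ∃ z : ℤ_[2], z ^ 2 = (m : ℤ_[2]) := by
      intro m hm
      apply aux_sqrt _ 1
      have h1 : ‖((1 - m : ℤ) : ℤ_[2])‖ ≤ (2 : ℕ) ^ (-(3 : ℕ) : ℤ) := by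
        rw [PadicInt.norm_int_le_pow_iff_dvd]
        exact_mod_cast hm
      have h3 : ‖(2 : ℤ_[2])‖ = 2⁻¹ := by
        simpa using PadicInt.norm_p (p := 2)
      rw [mul_one, h3]
      push_cast at h1
      rw [one_pow]
      refine lt_of_le_of_lt h1 ?_
      norm_num
    rcases (by omega : p % 8 = 7 ∨ p % 8 = 3) with h | h
    · obtain ⟨z, hz⟩ := key (-p) (by omega)
      exact ⟨z, 0, by rw [hz]; push_cast; ring⟩
    · obtain ⟨z, hz⟩ := key (-p - 4) (by omega)
      exact ⟨z, 2, by rw [hz]; push_cast; ring⟩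
  · obtain ⟨a, b, hab⟩ := ZMod.sq_add_sq ℓ (-(p : ZMod ℓ))
    have hs : ∀ a : ZMod ℓ, PadicInt.toZMod ((a.val : ℕ) : ℤ_[ℓ]) = a := by
      intro a; rw [map_natCast, ZMod.natCast_zmod_val]
    by_cases ha : a = 0
    · have hb : b ≠ 0 := by
        rintro rfl
        subst ha
        have : (p : ZMod ℓ) = 0 := by simpa using hab.symm
        rw [ZMod.natCast_eq_zero_iff] at this
        exact hne ((Nat.prime_dvd_prime_iff_eq hl.out hp.out).1 this)
      refine aux_odd h2 _ (b.val : ℤ_[ℓ]) (a.val : ℤ_[ℓ]) ?_ (by rwa [hs])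
      rw [map_add, map_pow, map_pow, hs, hs, map_neg, map_natCast, ← hab, add_comm]
    · refine aux_odd h2 _ (a.val : ℤ_[ℓ]) (b.val : ℤ_[ℓ]) ?_ (by rwa [hs])
      rw [map_add, map_pow, map_pow, hs, hs, map_neg, map_natCast, ← hab]

lemma aux_split {K : Type*} [Field K] [CharZero K] (c x y : K) (hc : c ≠ 0)
    (h : x ^ 2 + y ^ 2 = -c) : Nonempty (ℍ[K, -1, -c] ≃ₐ[K] Matrix (Fin 2) (Fin 2) K) := by
  let B : QuaternionAlgebra.Basis (Matrix (Fin 2) (Fin 2) K) (-1 : K) 0 (-c) :=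
    { i := !![0, -1; 1, 0]
      j := !![x, y; y, -x]
      k := !![-y, x; x, y]
      i_mul_i := by ext i j; fin_cases i <;> fin_cases j <;> simp
      j_mul_j := by
        ext i j; fin_cases i <;> fin_cases j <;> simp [← h] <;> ring
      i_mul_j := by ext i j; fin_cases i <;> fin_cases j <;> simp
      j_mul_i := by ext i j; fin_cases i <;> fin_cases j <;> simp }
  have hinj : Function.Injective B.liftHom := by
    rw [injective_iff_map_eq_zero]
    rintro ⟨a, b, d, e⟩ hx
    have e00 := congrFun (congrFun hx 0) 0
    have e01 := congrFun (congrFun hx 0) 1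
    have e10 := congrFun (congrFun hx 1) 0
    have e11 := congrFun (congrFun hx 1) 1
    simp [QuaternionAlgebra.Basis.lift, B, Matrix.algebraMap_matrix_apply] at e00 e01 e10 e11
    have ha : a = 0 := by linear_combination (e00 + e11) / 2
    have hb : b = 0 := by linear_combination (e10 - e01) / 2
    subst ha hb
    have hd : c * d = 0 := by linear_combination -x * e00 - y * e01 + d * h
    have he : c * e = 0 := by linear_combination y * e00 - x * e01 + e * h
    have hd := (mul_eq_zero.1 hd).resolve_left hc
    have he := (mul_eq_zero.1 he).resolve_left hc
    subst hd he
    rfl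
  refine ⟨AlgEquiv.ofBijective B.liftHom ⟨hinj, ?_⟩⟩
  have := (LinearMap.injective_iff_surjective_of_finrank_eq_finrank
    (f := B.liftHom.toLinearMap) (by
      rw [QuaternionAlgebra.finrank_eq_four, Module.finrank_matrix]; simp)).1 hinj
  exact this

lemma aux_norm_le (p : ℕ) [hp : Fact p.Prime] (hp4 : p % 4 = 3) (a b : ℚ_[p]) (ha : a ≠ 0)
    (hab : ‖b‖ ≤ ‖a‖) : ‖a ^ 2 + b ^ 2‖ = ‖a‖ ^ 2 := by
  have ht : ‖b / a‖ ≤ 1 := by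
    rw [norm_div]; exact div_le_one_of_le₀ hab (norm_nonneg _)
  let t : ℤ_[p] := ⟨b / a, ht⟩
  have h1 : ‖1 + t ^ 2‖ = 1 := by
    apply aux_norm_one
    intro h0
    simp only [map_add, map_one, map_pow] at h0
    refine ZMod.mod_four_ne_three_of_sq_eq_neg_one (p := p) (y := PadicInt.toZMod t) ?_ hp4
    linear_combination h0
  have h2 : ‖1 + (b / a) ^ 2‖ = 1 := by
    rw [PadicInt.norm_def] at h1
    exact h1
  have : a ^ 2 + b ^ 2 = a ^ 2 * (1 + (b / a) ^ 2) := by field_simp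
  rw [this, norm_mul, h2, mul_one, norm_pow]

lemma aux_norm (p : ℕ) [hp : Fact p.Prime] (hp4 : p % 4 = 3) (a b : ℚ_[p]) :
    (a = 0 ∧ b = 0) ∨ ∃ n : ℤ, ‖a ^ 2 + b ^ 2‖ = (p : ℝ) ^ (2 * n) := by
  have key : ∀ a b : ℚ_[p], a ≠ 0 → ‖b‖ ≤ ‖a‖ → ∃ n : ℤ, ‖a ^ 2 + b ^ 2‖ = (p : ℝ) ^ (2 * n) := by
    intro a b ha hab
    refine ⟨-a.valuation, ?_⟩
    rw [aux_norm_le p hp4 a b ha hab, Padic.norm_eq_zpow_neg_valuation ha, mul_comm, zpow_mul]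
    rfl
  rcases le_total ‖b‖ ‖a‖ with h | h
  · by_cases ha : a = 0
    · left; subst ha; simpa using h
    · right; exact key a b ha h
  · by_cases hb : b = 0
    · left; subst hb; simpa using h
    · right; rw [add_comm]; exact key b a hb h

/-- Pizer's lemma, case `p ≡ 3 (mod 4)`: the quaternion algebra `(-1, -p / ℚ)` is
ramified exactly at `p` and `∞`. -/
theorem quaternionAlgebra_neg_one_neg_p_ramified_exactly_at_p_and_infty
    (p : ℕ) [hp : Fact p.Prime] (hp4 : p % 4 = 3) :
    (∀ x : ℍ[ℝ, -1, -(p : ℝ)], x ≠ 0 → IsUnit x) ∧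
    (∀ x : ℍ[ℚ_[p], -1, -(p : ℚ_[p])], x ≠ 0 → IsUnit x) ∧
    (∀ (ℓ : ℕ) [Fact ℓ.Prime], ℓ ≠ p →
      Nonempty (ℍ[ℚ_[ℓ], -1, -(p : ℚ_[ℓ])] ≃ₐ[ℚ_[ℓ]] Matrix (Fin 2) (Fin 2) ℚ_[ℓ])) := by
  have hp0 : (0 : ℝ) < p := by exact_mod_cast hp.out.pos
  refine ⟨aux_unit _ ?_, aux_unit _ ?_, ?_⟩
  · intro a b d e h
    have h1 := mul_nonneg hp0.le (sq_nonneg d)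
    have h2 := mul_nonneg hp0.le (sq_nonneg e)
    have h3 := sq_nonneg a
    have h4 := sq_nonneg b
    refine ⟨?_, ?_, ?_, ?_⟩
    · exact pow_eq_zero_iff two_ne_zero |>.1 (by linarith)
    · exact pow_eq_zero_iff two_ne_zero |>.1 (by linarith)
    · have : (p : ℝ) * d ^ 2 = 0 := by linarith
      simpa [hp0.ne'] using this
    · have : (p : ℝ) * e ^ 2 = 0 := by linarith
      simpa [hp0.ne'] using this
  · intro a b d e h
    have hpp : (p : ℚ_[p]) ≠ 0 := by exact_mod_cast hp.out.ne_zero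
    have hN : ‖a ^ 2 + b ^ 2‖ = (p : ℝ)⁻¹ * ‖d ^ 2 + e ^ 2‖ := by
      rw [eq_neg_of_add_eq_zero_left h, norm_neg, norm_mul, Padic.norm_p]
    rcases aux_norm p hp4 a b with ⟨rfl, rfl⟩ | ⟨n, hn⟩ <;>
    rcases aux_norm p hp4 d e with ⟨rfl, rfl⟩ | ⟨m, hm⟩
    · simp
    · rw [hm] at hN
      have : (p : ℝ) ^ (2 * m) ≠ 0 := zpow_ne_zero _ hp0.ne'
      simp [hp0.ne', this] at hN
    · rw [hn] at hN
      have : (p : ℝ) ^ (2 * n) ≠ 0 := zpow_ne_zero _ hp0.ne'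
      simp [hp0.ne', this] at hN
    · exfalso
      rw [hn, hm, ← zpow_neg_one, ← zpow_add₀ hp0.ne'] at hN
      have := zpow_right_injective₀ hp0 (by exact_mod_cast hp.out.ne_one) hN
      omega
  · intro ℓ _ hne
    obtain ⟨x, y, hxy⟩ := aux_exists p hp4 ℓ hne
    refine aux_split _ (x : ℚ_[ℓ]) (y : ℚ_[ℓ]) (by exact_mod_cast hp.out.ne_zero) ?_
    exact_mod_cast congrArg (fun z : ℤ_[ℓ] => (z : ℚ_[ℓ])) hxy
end

section
/- Let p be a prime with p ≡ 1 (mod 8), and let q be a prime with q ≡ 3 (mod 4) such that the Legendre symbol (p / q) equals −1. Then the quaternion algebra (−q, −p / ℚ) is ramified exactly at p and at ∞; concretely: the base change of (−q, −p / ℚ) to ℝ is a division ring, the base change of (−q, −p / ℚ) to the p-adic field ℚ_p is a division ring, and for every prime ℓ ≠ p the base change of (−q, −p / ℚ) to ℚ_ℓ is isomorphic as a ℚ_ℓ-algebra to the ring of 2×2 matrices over ℚ_ℓ. -/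
open Quaternion

section Helpers

open Polynomial

lemma aux_hensel {l : ℕ} [Fact l.Prime] (u n : ℤ)
    (h : ‖((n ^ 2 - u : ℤ) : ℤ_[l])‖ < ‖((2 * n : ℤ) : ℤ_[l])‖ ^ 2) :
    ∃ s : ℚ_[l], s ^ 2 = (u : ℚ_[l]) := by
  have := hensels_lemma (p := l) (F := (X ^ 2 - C (u : ℤ_[l]) : ℤ_[l][X])) (a := (n : ℤ_[l]))
    (by simpa [derivative_pow] using h)
  obtain ⟨z, hz, -⟩ := this
  refine ⟨(z : ℚ_[l]), ?_⟩
  have h2 : z ^ 2 = (u : ℤ_[l]) := by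
    simpa [sub_eq_zero] using hz
  have := congrArg (fun t : ℤ_[l] => (t : ℚ_[l])) h2
  simpa using this

lemma aux_hensel_odd {l : ℕ} [hl : Fact l.Prime] (hl2 : l ≠ 2) (u n : ℤ)
    (hn : ¬ (l : ℤ) ∣ n) (h : (l : ℤ) ∣ n ^ 2 - u) :
    ∃ s : ℚ_[l], s ^ 2 = (u : ℚ_[l]) := by
  apply aux_hensel u n
  have h1 : ‖((n ^ 2 - u : ℤ) : ℤ_[l])‖ < 1 := PadicInt.norm_int_lt_one_iff_dvd _ |>.2 h
  have h2 : ‖((2 * n : ℤ) : ℤ_[l])‖ = 1 := by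
    apply le_antisymm (PadicInt.norm_le_one _)
    by_contra hc
    have := (PadicInt.norm_int_lt_one_iff_dvd _).1 (not_le.1 hc)
    rcases (Nat.prime_iff_prime_int.1 hl.out).dvd_or_dvd this with h3 | h3
    · have h4 : l ∣ 2 := by exact_mod_cast h3
      exact hl2 ((Nat.prime_dvd_prime_iff_eq hl.out Nat.prime_two).1 h4)
    · exact hn h3
  rw [h2]; simpa using h1

lemma aux_hensel_two (u : ℤ) (h : (8 : ℤ) ∣ 1 - u) :
    ∃ s : ℚ_[2], s ^ 2 = (u : ℚ_[2]) := by
  apply aux_hensel u 1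
  have h1 : ‖((1 ^ 2 - u : ℤ) : ℤ_[2])‖ ≤ (2 : ℝ) ^ (-3 : ℤ) := by
    have := (PadicInt.norm_int_le_pow_iff_dvd (p := 2) (k := 1 ^ 2 - u) (n := 3)).2
      (by norm_num; exact h)
    simpa using this
  have h2 : ‖((2 * 1 : ℤ) : ℤ_[2])‖ = (2 : ℝ)⁻¹ := by
    have := PadicInt.norm_p (p := 2)
    simpa using this
  rw [h2]
  refine lt_of_le_of_lt h1 (by norm_num)

lemma aux_split_odd {l : ℕ} [hl : Fact l.Prime] (hl2 : l ≠ 2) (A B : ℤ)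
    (hA : ¬ (l : ℤ) ∣ A) (hB : ¬ (l : ℤ) ∣ B) :
    ∃ z w : ℚ_[l], (A : ℚ_[l]) = z ^ 2 - B * w ^ 2 := by
  have hB0 : (B : ZMod l) ≠ 0 := fun h => hB ((ZMod.intCast_zmod_eq_zero_iff_dvd _ _).1 h)
  have hB1 : (B : ℚ_[l]) ≠ 0 := by
    intro h
    have : B = 0 := by exact_mod_cast h
    exact hB (by simp [this])
  have hcard : Fintype.card (ZMod l) % 2 = 1 := by
    rw [ZMod.card]
    exact Nat.odd_iff.1 (hl.out.odd_of_ne_two hl2)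
  obtain ⟨z, w, hzw⟩ := FiniteField.exists_root_sum_quadratic
    (f := (X ^ 2 - C (A : ZMod l))) (g := C (-(B : ZMod l)) * X ^ 2)
    (degree_X_pow_sub_C (by norm_num) _) (degree_C_mul_X_pow 2 (neg_ne_zero.2 hB0)) hcard
  obtain ⟨z, rfl⟩ := ZMod.intCast_surjective z
  obtain ⟨w, rfl⟩ := ZMod.intCast_surjective w
  have hd : (l : ℤ) ∣ z ^ 2 - A - B * w ^ 2 := by
    rw [← ZMod.intCast_zmod_eq_zero_iff_dvd]
    push_cast
    simp at hzw
    linear_combination hzw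
  by_cases hz : (l : ℤ) ∣ z
  · have hw : ¬ (l : ℤ) ∣ w := by
      intro hw
      apply hA
      have : A = z * z - B * w * w - (z ^ 2 - A - B * w ^ 2) := by ring
      rw [this]
      exact dvd_sub (dvd_sub (hz.mul_right _) (hw.mul_left _)) hd
    obtain ⟨s, hs⟩ := aux_hensel_odd hl2 (B * z ^ 2 - A * B) (B * w)
      (fun h => ((Nat.prime_iff_prime_int.1 hl.out).dvd_or_dvd h).elim hB hw)
      (by
        have : (B * w) ^ 2 - (B * z ^ 2 - A * B) = (z ^ 2 - A - B * w ^ 2) * (-B) := by ring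
        rw [this]; exact hd.mul_right _)
    refine ⟨z, s / B, ?_⟩
    push_cast at hs
    field_simp
    rw [hs]; ring
  · obtain ⟨s, hs⟩ := aux_hensel_odd hl2 (A + B * w ^ 2) z hz (by
      have : z ^ 2 - (A + B * w ^ 2) = z ^ 2 - A - B * w ^ 2 := by ring
      rwa [this])
    refine ⟨s, w, ?_⟩
    push_cast at hs
    rw [hs]; ring

lemma aux_iso {K : Type*} [Field K] [CharZero K] (a b z w : K) (ha : a ≠ 0) (hb : b ≠ 0)
    (h : a = z ^ 2 - b * w ^ 2) : Nonempty (ℍ[K, a, b] ≃ₐ[K] Matrix (Fin 2) (Fin 2) K) := by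
  let B : QuaternionAlgebra.Basis (Matrix (Fin 2) (Fin 2) K) a 0 b :=
    { i := !![z, -b * w; w, -z]
      j := !![0, b; 1, 0]
      k := !![-b * w, z * b; -z, w * b]
      i_mul_i := by
        ext i j
        fin_cases i <;> fin_cases j <;> simp [Matrix.mul_apply, Fin.sum_univ_two, h] <;> ring
      j_mul_j := by
        ext i j
        fin_cases i <;> fin_cases j <;> simp [Matrix.mul_apply, Fin.sum_univ_two]
      i_mul_j := by
        ext i j
        fin_cases i <;> fin_cases j <;> simp [Matrix.mul_apply, Fin.sum_univ_two]
      j_mul_i := by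
        ext i j
        fin_cases i <;> fin_cases j <;> simp [Matrix.mul_apply, Fin.sum_univ_two] <;> ring }
  have hinj : Function.Injective B.liftHom := by
    rw [injective_iff_map_eq_zero]
    intro x hx
    have hx' : B.lift x = 0 := hx
    have e00 := congrFun (congrFun hx' 0) 0
    have e01 := congrFun (congrFun hx' 0) 1
    have e10 := congrFun (congrFun hx' 1) 0
    have e11 := congrFun (congrFun hx' 1) 1
    simp [QuaternionAlgebra.Basis.lift, B, Matrix.algebraMap_matrix_apply] at e00 e01 e10 e11
    obtain ⟨t, x, y, v⟩ := x
    simp only at e00 e01 e10 e11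
    have two : (2 : K) ≠ 0 := two_ne_zero
    have ht : t = 0 := mul_left_cancel₀ two (by linear_combination e00 + e11)
    have e01' : -(w * x) + y + v * z = 0 := mul_left_cancel₀ hb (by linear_combination e01)
    have hy : y = 0 := mul_left_cancel₀ two (by linear_combination e01' + e10)
    subst ht hy
    have hx0 : x = 0 := mul_left_cancel₀ ha (by rw [h]; linear_combination z * e00 - b * w * e10)
    have hv0 : v = 0 := mul_left_cancel₀ ha (by rw [h]; linear_combination w * e00 - z * e10)
    subst hx0 hv0
    rfl
  have hfr : Module.finrank K ℍ[K, a, b] = Module.finrank K (Matrix (Fin 2) (Fin 2) K) := by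
    rw [QuaternionAlgebra.finrank_eq_four, Module.finrank_matrix]; simp
  have hsurj : Function.Surjective B.liftHom :=
    (LinearMap.injective_iff_surjective_of_finrank_eq_finrank (f := B.liftHom.toLinearMap) hfr).1
      hinj
  exact ⟨AlgEquiv.ofBijective B.liftHom ⟨hinj, hsurj⟩⟩

lemma aux_unit_s2 {K : Type*} [Field K] (q p : K)
    (h : ∀ t x y v : K, t ^ 2 + q * x ^ 2 + p * (y ^ 2 + q * v ^ 2) = 0 →
      t = 0 ∧ x = 0 ∧ y = 0 ∧ v = 0) (x : ℍ[K, -q, -p]) (hx : x ≠ 0) : IsUnit x := by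
  obtain ⟨t, x, y, v⟩ := x
  set n := t ^ 2 + q * x ^ 2 + p * (y ^ 2 + q * v ^ 2) with hn
  have hn0 : n ≠ 0 := by
    intro h0
    obtain ⟨rfl, rfl, rfl, rfl⟩ := h _ _ _ _ h0
    exact hx rfl
  refine ⟨⟨⟨t, x, y, v⟩, ⟨n⁻¹ * t, -(n⁻¹ * x), -(n⁻¹ * y), -(n⁻¹ * v)⟩, ?_, ?_⟩, rfl⟩
  all_goals
    ext
    · simp
      field_simp
      rw [hn]; ring
    all_goals
      simp
      try ring

lemma aux_norm_s2 {p : ℕ} [hp : Fact p.Prime] (q : ℕ)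
    (hs : ¬ IsSquare (-(q : ZMod p))) (t x : ℚ_[p]) :
    ∃ c : ℚ_[p], ‖t ^ 2 + q * x ^ 2‖ = ‖c‖ ^ 2 ∧ (c = 0 → t = 0 ∧ x = 0) := by
  have key : ∀ u : ℤ_[p], PadicInt.toZMod u ≠ 0 → ‖u‖ = 1 := by
    intro u hu
    apply le_antisymm (PadicInt.norm_le_one _)
    by_contra hc
    apply hu
    have : u ∈ IsLocalRing.maximalIdeal ℤ_[p] := by
      rw [IsLocalRing.mem_maximalIdeal, PadicInt.mem_nonunits]; exact not_le.1 hc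
    rwa [← PadicInt.ker_toZMod, RingHom.mem_ker] at this
  rcases le_total ‖x‖ ‖t‖ with hle | hle
  · refine ⟨t, ?_, ?_⟩
    · by_cases ht : t = 0
      · have : x = 0 := by simpa [ht] using hle
        simp [ht, this]
      have hu : ‖x / t‖ ≤ 1 := by
        rw [norm_div]; exact div_le_one_of_le₀ hle (norm_nonneg _)
      obtain ⟨u, hu'⟩ : ∃ u : ℤ_[p], (u : ℚ_[p]) = x / t := ⟨⟨x / t, hu⟩, rfl⟩
      have := key (1 + q * u ^ 2) (by
        simp only [map_add, map_one, map_mul, map_natCast, map_pow]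
        set r := PadicInt.toZMod u
        intro h0
        have hr : r ≠ 0 := by rintro h; simp [h] at h0
        exact hs ⟨r⁻¹, by field_simp; linear_combination -h0⟩)
      have h2 : ‖1 + (q : ℚ_[p]) * (x / t) ^ 2‖ = 1 := by
        rw [← this, PadicInt.norm_def]; push_cast; rw [hu']
      have h3 : t ^ 2 + q * x ^ 2 = t ^ 2 * (1 + (q : ℚ_[p]) * (x / t) ^ 2) := by
        field_simp
      rw [h3, norm_mul, h2, norm_pow, mul_one]
    · rintro rfl
      exact ⟨rfl, by simpa using hle⟩
  · refine ⟨x, ?_, ?_⟩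
    · by_cases ht : x = 0
      · have : t = 0 := by simpa [ht] using hle
        simp [ht, this]
      have hu : ‖t / x‖ ≤ 1 := by
        rw [norm_div]; exact div_le_one_of_le₀ hle (norm_nonneg _)
      obtain ⟨u, hu'⟩ : ∃ u : ℤ_[p], (u : ℚ_[p]) = t / x := ⟨⟨t / x, hu⟩, rfl⟩
      have := key (u ^ 2 + q) (by
        simp only [map_add, map_natCast, map_pow]
        set r := PadicInt.toZMod u
        intro h0
        exact hs ⟨r, by linear_combination -h0⟩)
      have h2 : ‖(t / x) ^ 2 + (q : ℚ_[p])‖ = 1 := by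
        rw [← this, PadicInt.norm_def]; push_cast; rw [hu']
      have h3 : t ^ 2 + q * x ^ 2 = x ^ 2 * ((t / x) ^ 2 + (q : ℚ_[p])) := by
        field_simp
      rw [h3, norm_mul, h2, norm_pow, mul_one]
    · rintro rfl
      exact ⟨by simpa using hle, rfl⟩

lemma aux_aniso {p : ℕ} [hp : Fact p.Prime] (q : ℕ)
    (hs : ¬ IsSquare (-(q : ZMod p))) (t x y v : ℚ_[p])
    (h : t ^ 2 + q * x ^ 2 + p * (y ^ 2 + q * v ^ 2) = 0) :
    t = 0 ∧ x = 0 ∧ y = 0 ∧ v = 0 := by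
  obtain ⟨c, hc, hc0⟩ := aux_norm_s2 q hs t x
  obtain ⟨d, hd, hd0⟩ := aux_norm_s2 q hs y v
  have hp0 : (0 : ℝ) < p := by exact_mod_cast hp.out.pos
  have e : ‖c‖ ^ 2 = (p : ℝ)⁻¹ * ‖d‖ ^ 2 := by
    rw [← hc, ← hd, ← Padic.norm_p, ← norm_mul, eq_neg_of_add_eq_zero_left h, norm_neg]
  by_cases c0 : c = 0
  · have d0 : d = 0 := by
      have : ‖d‖ ^ 2 = 0 := by
        rw [c0] at e
        have := e.symm
        simpa [hp0.ne', hp.out.ne_zero] using this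
      simpa using this
    exact ⟨(hc0 c0).1, (hc0 c0).2, (hd0 d0).1, (hd0 d0).2⟩
  · exfalso
    have d0 : d ≠ 0 := by
      rintro rfl
      simp at e
      exact c0 e
    rw [Padic.norm_eq_zpow_neg_valuation c0, Padic.norm_eq_zpow_neg_valuation d0,
      ← zpow_neg_one, ← zpow_natCast, ← zpow_natCast, ← zpow_mul, ← zpow_mul,
      ← zpow_add₀ hp0.ne'] at e
    have := zpow_right_injective₀ hp0 (by exact_mod_cast hp.out.one_lt.ne') e
    push_cast at this
    omega

end Helpers

/-- Pizer's lemma, case `p ≡ 1 (mod 8)`: for a prime `q ≡ 3 (mod 4)` with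
Legendre symbol `(p/q) = -1`, the quaternion algebra `(-q, -p / ℚ)` is
ramified exactly at `p` and `∞`. -/
theorem quaternionAlgebra_neg_q_neg_p_ramified_exactly_at_p_and_infty
    (p q : ℕ) [hp : Fact p.Prime] [hq : Fact q.Prime]
    (hp8 : p % 8 = 1) (hq4 : q % 4 = 3) (hleg : legendreSym q p = -1) :
    (∀ x : ℍ[ℝ, -(q : ℝ), -(p : ℝ)], x ≠ 0 → IsUnit x) ∧
    (∀ x : ℍ[ℚ_[p], -(q : ℚ_[p]), -(p : ℚ_[p])], x ≠ 0 → IsUnit x) ∧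
    (∀ (ℓ : ℕ) [Fact ℓ.Prime], ℓ ≠ p →
      Nonempty (ℍ[ℚ_[ℓ], -(q : ℚ_[ℓ]), -(p : ℚ_[ℓ])] ≃ₐ[ℚ_[ℓ]] Matrix (Fin 2) (Fin 2) ℚ_[ℓ])) := by
  have hp4 : p % 4 = 1 := by omega
  have hq2 : q ≠ 2 := by rintro rfl; omega
  have hp2 : p ≠ 2 := by rintro rfl; omega
  have hqpos : 0 < q := hq.out.pos
  have hppos : 0 < p := hp.out.pos
  refine ⟨?_, ?_, ?_⟩
  · apply aux_unit_s2
    intro t x y v h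
    have hq' : (0 : ℝ) < q := by exact_mod_cast hqpos
    have hp' : (0 : ℝ) < p := by exact_mod_cast hppos
    have h1 := sq_nonneg t
    have h2 := mul_nonneg hq'.le (sq_nonneg x)
    have h3 := mul_nonneg hp'.le (sq_nonneg y)
    have h4 := mul_nonneg hp'.le (mul_nonneg hq'.le (sq_nonneg v))
    have g1 : t ^ 2 = 0 := by nlinarith
    have g2 : q * x ^ 2 = 0 := by nlinarith
    have g3 : p * y ^ 2 = 0 := by nlinarith
    have g4 : p * (q * v ^ 2) = 0 := by nlinarith
    simp [hq'.ne', hp'.ne', hq.out.ne_zero, hp.out.ne_zero] at g1 g2 g3 g4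
    exact ⟨g1, g2, g3, g4⟩
  · apply aux_unit_s2
    apply aux_aniso
    have h1 : legendreSym p q = -1 := by
      rw [← hleg]; exact (legendreSym.quadratic_reciprocity_one_mod_four hp4 hq2).symm
    rw [legendreSym.eq_neg_one_iff] at h1
    have h2 : IsSquare (-1 : ZMod p) := ZMod.exists_sq_eq_neg_one_iff.2 (by omega)
    intro h3
    apply h1
    have := h2.mul h3
    simpa using this
  · intro l hl hlp
    have hq0 : -(q : ℚ_[l]) ≠ 0 := neg_ne_zero.2 (by exact_mod_cast hqpos.ne')
    have hp0 : -(p : ℚ_[l]) ≠ 0 := neg_ne_zero.2 (by exact_mod_cast hppos.ne')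
    suffices ∃ z w : ℚ_[l], -(q : ℚ_[l]) = z ^ 2 - -(p : ℚ_[l]) * w ^ 2 by
      obtain ⟨z, w, h⟩ := this
      exact aux_iso _ _ z w hq0 hp0 h
    by_cases hl2 : l = 2
    · subst hl2
      obtain ⟨s, hs⟩ := aux_hensel_two p (by omega)
      push_cast at hs
      have hs0 : s ≠ 0 := by rintro rfl; apply hp0; rw [← hs]; simp
      rcases (by omega : q % 8 = 7 ∨ q % 8 = 3) with h8 | h8
      · obtain ⟨z, hz⟩ := aux_hensel_two (-q) (by omega)
        push_cast at hz
        exact ⟨z, 0, by rw [hz]; ring⟩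
      · obtain ⟨z, hz⟩ := aux_hensel_two (-q - 4) (by omega)
        push_cast at hz
        refine ⟨z, 2 / s, ?_⟩
        rw [hz, ← hs]
        field_simp
        ring
    by_cases hlq : l = q
    · subst hlq
      have h1 : legendreSym l (-p) = 1 := by
        rw [← neg_one_mul, legendreSym.mul, hleg, legendreSym.at_neg_one hl2,
          ZMod.χ₄_nat_three_mod_four hq4]
        norm_num
      have hne : ((-p : ℤ) : ZMod l) ≠ 0 := by
        intro h
        rw [(legendreSym.eq_zero_iff l (-p)).2 h] at h1
        norm_num at h1
      obtain ⟨r, hr⟩ := (legendreSym.eq_one_iff l hne).1 h1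
      obtain ⟨n, rfl⟩ := ZMod.intCast_surjective r
      obtain ⟨s, hs⟩ := aux_hensel_odd hl2 (-p) n
        (by
          intro h
          rw [← ZMod.intCast_zmod_eq_zero_iff_dvd] at h
          apply hne; rw [hr, h, mul_zero])
        (by
          rw [← ZMod.intCast_zmod_eq_zero_iff_dvd, Int.cast_sub, hr]
          push_cast; ring)
      push_cast at hs
      have hs0 : s ≠ 0 := by rintro rfl; apply hp0; rw [← hs]; simp
      refine ⟨(1 - l) / 2, (1 + l) / (2 * s), ?_⟩
      rw [← hs]
      field_simp
      ring
    · have key : ∀ r : ℕ, r.Prime → l ≠ r → ¬ (l : ℤ) ∣ -(r : ℤ) := by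
        intro r hr hne h
        rw [dvd_neg] at h
        exact hne ((Nat.prime_dvd_prime_iff_eq hl.out hr).1 (by exact_mod_cast h))
      obtain ⟨z, w, h⟩ := aux_split_odd hl2 (-q) (-p) (key q hq.out hlq) (key p hp.out hlp)
      push_cast at h
      exact ⟨z, w, h⟩
end

section
/- Let ℓ be a prime number and let R and R' be rings, each of which is isomorphic as a ring to M₂(𝔽_ℓ), the ring of 2×2 matrices over the field with ℓ elements. Let ι₁, ι₂ : R → R' be two ring isomorphisms. If for every left ideal I of R the image ι₁(I) equals the image ι₂(I) (as subsets of R'), then ι₁ = ι₂. -/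
/-- Corollary 5.3 of the paper: a ring isomorphism between two copies of `M₂(𝔽_ℓ)`
is determined by its action on left ideals. -/
theorem ringEquiv_eq_of_maps_left_ideals_eq
    (ℓ : ℕ) (hℓ : ℓ.Prime)
    (R R' : Type*) [Ring R] [Ring R']
    (hR : Nonempty (R ≃+* Matrix (Fin 2) (Fin 2) (ZMod ℓ)))
    (hR' : Nonempty (R' ≃+* Matrix (Fin 2) (Fin 2) (ZMod ℓ)))
    (ι₁ ι₂ : R ≃+* R')
    (h : ∀ I : Ideal R, ι₁ '' (I : Set R) = ι₂ '' (I : Set R)) :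
    ι₁ = ι₂ := by
  have : NeZero ℓ := ⟨hℓ.ne_zero⟩
  have key : ∀ e : R, e * e = e → ι₁ e * ι₂ e = ι₁ e := by
    intro e he
    have h1 : ι₁ e ∈ ι₂ '' ((Ideal.span {e} : Ideal R) : Set R) := by
      rw [← h]
      exact ⟨e, Ideal.subset_span rfl, rfl⟩
    obtain ⟨x, hx, hxe⟩ := h1
    obtain ⟨a, rfl⟩ := Ideal.mem_span_singleton'.1 hx
    rw [← hxe, ← map_mul, mul_assoc, he]
  have idem : ∀ e : R, e * e = e → ι₁ e = ι₂ e := by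
    intro e he
    have h1 := key e he
    have h2 := key (1 - e) (by simp [mul_sub, sub_mul, he])
    simp only [map_sub, map_one, mul_sub, sub_mul, one_mul, mul_one, h1] at h2
    simpa [sub_eq_zero, eq_comm] using h2
  obtain ⟨e⟩ := hR
  let T : AddSubgroup (Matrix (Fin 2) (Fin 2) (ZMod ℓ)) :=
    AddMonoidHom.eqLocus ((ι₁ : R →+* R').comp (e.symm : _ →+* R)).toAddMonoidHom
      ((ι₂ : R →+* R').comp (e.symm : _ →+* R)).toAddMonoidHom
  have hT : ∀ M, M * M = M → M ∈ T := by
    intro M hM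
    exact idem (e.symm M) (by rw [← map_mul, hM])
  have h11 : !![1, 0; 0, 0] ∈ T := hT _ (by rw [Matrix.mul_fin_two]; norm_num)
  have h22 : !![0, 0; 0, 1] ∈ T := hT _ (by rw [Matrix.mul_fin_two]; norm_num)
  have h12 : !![1, 1; 0, 0] ∈ T := hT _ (by rw [Matrix.mul_fin_two]; norm_num)
  have h21 : !![0, 0; 1, 1] ∈ T := hT _ (by rw [Matrix.mul_fin_two]; norm_num)
  have all : ∀ M, M ∈ T := by
    intro M
    have : M = (M 0 0).val • !![1, 0; 0, 0] + (M 1 1).val • !![0, 0; 0, 1]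
        + (M 0 1).val • (!![1, 1; 0, 0] - !![1, 0; 0, 0])
        + (M 1 0).val • (!![0, 0; 1, 1] - !![0, 0; 0, 1]) := by
      ext i j
      fin_cases i <;> fin_cases j <;> simp
    rw [this]
    exact T.add_mem (T.add_mem (T.add_mem (T.nsmul_mem h11 _) (T.nsmul_mem h22 _))
      (T.nsmul_mem (T.sub_mem h12 h11) _)) (T.nsmul_mem (T.sub_mem h21 h22) _)
  ext x
  have := all (e x)
  change ι₁ (e.symm (e x)) = ι₂ (e.symm (e x)) at this
  simpa using this
end

section
/- For every prime number ℓ, the real inequality (2·√ℓ)/(ℓ + 1) ≤ (2√2/3)^(log₂ ℓ) holds, where log₂ denotes the logarithm in base 2 and the right-hand side is a real power. -/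
/-- For every prime `ℓ`, the spectral ratio `(2√ℓ)/(ℓ+1)` of the supersingular
`ℓ`-isogeny graph is at most `(2√2/3) ^ (log₂ ℓ)`. -/
theorem expansion_ratio_le_rpow_logb (ℓ : ℕ) (hℓ : ℓ.Prime) :
    (2 * Real.sqrt ℓ) / (ℓ + 1) ≤
      (2 * Real.sqrt 2 / 3) ^ (Real.logb 2 ℓ) := by
  have h2 : (2:ℝ) ≤ ℓ := by exact_mod_cast hℓ.two_le
  have hpos : (0:ℝ) < ℓ := by linarith
  obtain ⟨t, ht⟩ : ∃ t, t = Real.logb 2 (ℓ:ℝ) := ⟨_, rfl⟩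
  have e : (2:ℝ) ^ t = ℓ := by
    rw [ht]; exact Real.rpow_logb (by norm_num) (by norm_num) hpos
  have t1 : 1 ≤ t := by
    rw [ht, Real.le_logb_iff_rpow_le (by norm_num) hpos]; simpa using h2
  rw [← ht]
  have b1 := one_add_mul_self_le_rpow_one_add (s := 1/3) (by norm_num) t1
  have b2 := one_add_mul_self_le_rpow_one_add (s := -1/3) (by norm_num) t1
  have e1 : (1 + 1/3 : ℝ) ^ t = ℓ * ℓ / 3 ^ t := by
    rw [← e, ← Real.mul_rpow (by norm_num) (by norm_num),
      ← Real.div_rpow (by norm_num) (by norm_num)]; norm_num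
  have e2 : (1 + -1/3 : ℝ) ^ t = ℓ / 3 ^ t := by
    rw [← e, ← Real.div_rpow (by norm_num) (by norm_num)]; norm_num
  have e3 : (Real.sqrt 2) ^ t = Real.sqrt ℓ := by
    rw [← e, Real.sqrt_eq_rpow, Real.sqrt_eq_rpow, ← Real.rpow_mul (by norm_num),
      ← Real.rpow_mul (by norm_num), mul_comm]
  rw [Real.div_rpow (by positivity) (by norm_num), Real.mul_rpow (by norm_num) (by positivity),
    e, e3]
  have h3 : (0:ℝ) < 3 ^ t := by positivity
  rw [e1] at b1
  rw [e2] at b2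
  have key : 2 ≤ (ℓ * ℓ + ℓ : ℝ) / 3 ^ t := by rw [add_div]; linarith
  rw [le_div_iff₀ h3] at key
  rw [div_le_div_iff₀ (by positivity) h3]
  nlinarith [mul_le_mul_of_nonneg_right key (Real.sqrt_nonneg (ℓ:ℝ))]
end

section
/- For every integer N ≥ 2 with prime factorization N = ∏ᵢ ℓᵢ^{kᵢ}, one has the real inequality ∏ᵢ ((2·√ℓᵢ)/(ℓᵢ + 1))^{kᵢ} ≤ (2√2/3)^(log₂ N), where the product on the left runs over the distinct prime factors ℓᵢ of N with kᵢ the exponent of ℓᵢ in N. -/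
open scoped BigOperators

lemma ratio_aux (l : ℕ) (hl : 2 ≤ l) :
    (2 * Real.sqrt l) / (l + 1) ≤ (2 * Real.sqrt 2 / 3) ^ (Real.logb 2 l) := by
  have hl' : (2:ℝ) ≤ l := by exact_mod_cast hl
  set t := Real.logb 2 l with ht
  have h2t : (2:ℝ) ^ t = l := Real.rpow_logb (by norm_num) (by norm_num) (by linarith)
  have ht1 : 1 ≤ t := by
    rw [ht, Real.le_logb_iff_rpow_le (by norm_num) (by linarith)]
    simpa using hl'
  have hC := (convexOn_rpow ht1).2
  have hJ := hC (show (1:ℝ) ∈ Set.Ici 0 by simp) (show (2:ℝ) ∈ Set.Ici 0 by simp)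
    (show (0:ℝ) ≤ 1/2 by norm_num) (show (0:ℝ) ≤ 1/2 by norm_num) (by norm_num)
  simp only [smul_eq_mul] at hJ
  rw [h2t, Real.one_rpow, show (1/2*1+1/2*2:ℝ) = 3/2 by norm_num] at hJ
  have hs : (Real.sqrt 2) ^ t = Real.sqrt l := by
    rw [Real.sqrt_eq_rpow, Real.sqrt_eq_rpow, ← h2t, ← Real.rpow_mul (by norm_num),
      ← Real.rpow_mul (by norm_num), mul_comm]
  have hc : (2 * Real.sqrt 2 / 3) ^ t * (3/2:ℝ) ^ t = Real.sqrt l := by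
    rw [← Real.mul_rpow (by positivity) (by norm_num), ← hs]
    congr 1
    ring
  rw [div_le_iff₀ (by linarith), ← hc]
  have hp : 0 ≤ (2 * Real.sqrt 2 / 3) ^ t := by positivity
  nlinarith [mul_le_mul_of_nonneg_left hJ hp]

/-- For every `N ≥ 2` with prime factorization `N = ∏ ℓᵢ^{kᵢ}`, the product
`∏ ((2√ℓᵢ)/(ℓᵢ+1))^{kᵢ}` is at most `(2√2/3) ^ (log₂ N)`. -/
theorem prod_expansion_ratio_le_rpow_logb (N : ℕ) (hN : 2 ≤ N) :
    ∏ ℓ ∈ N.primeFactors,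
        ((2 * Real.sqrt ℓ) / (ℓ + 1)) ^ (N.factorization ℓ) ≤
      (2 * Real.sqrt 2 / 3) ^ (Real.logb 2 N) := by
  have hlog : Real.logb 2 N = ∑ l ∈ N.primeFactors, Real.logb 2 l * (N.factorization l : ℝ) := by
    have h := Real.log_nat_eq_sum_factorization N
    rw [Real.logb, h, Finsupp.sum, Nat.support_factorization, Finset.sum_div]
    refine Finset.sum_congr rfl fun l _ => ?_
    rw [Real.logb]
    ring
  rw [hlog, Real.rpow_sum_of_pos (by positivity)]
  refine Finset.prod_le_prod (fun l _ => by positivity) fun l hl => ?_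
  rw [Real.rpow_mul (by positivity), Real.rpow_natCast]
  exact pow_le_pow_left₀ (by positivity) (ratio_aux l (Nat.prime_of_mem_primeFactors hl).two_le) _
end
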